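/- Let α > 0. For every F ∈ C²((0,∞)) one has, at every point (z,σ) ∈ ℝ^N ∖ {(0,0)}, 𝓛_{α,2}(F∘ρ)(z,σ) = ( F''(ρ) + ((Q−1)/ρ) F'(ρ) ) (Φ⁰(z)/ρ)^{2α}, where ρ = ρ(z,σ) and Q = m + (α+1)k; in particular, the (nonlinear) operator 𝓛_{α,2} acts linearly on functions of ρ. -/

import Mathlib

open Real MeasureTheory
open scoped RealInnerProductSpace

noncomputable section

abbrev Euc (n : ℕ) := EuclideanSpace ℝ (Fin n)

/-- A Minkowski norm on `ℝⁿ`: nonnegative, absolutely homogeneous, with `N²` of class `C²`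
away from the origin and strictly convex. -/
def IsMinkowskiNorm {n : ℕ} (N : Euc n → ℝ) : Prop :=
  (∀ x, 0 ≤ N x) ∧ (∀ (l : ℝ) (x : Euc n), N (l • x) = |l| * N x) ∧
  ContDiffOn ℝ 2 (fun x => (N x) ^ 2) {(0 : Euc n)}ᶜ ∧
  StrictConvexOn ℝ Set.univ (fun x => (N x) ^ 2)

/-- The Legendre transform (dual norm) `N⁰(x) = sup { ⟨x,ξ⟩ : N(ξ) = 1 }`. -/
def dualNorm {n : ℕ} (N : Euc n → ℝ) (x : Euc n) : ℝ :=
  sSup ((fun ξ => ⟪x, ξ⟫) '' {ξ | N ξ = 1})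

variable {m k : ℕ}

/-- The dual anisotropic Minkowski gauge
`ρ(z,σ) = (Φ⁰(z)^{2(α+1)} + 4(α+1)²Ψ⁰(σ)²)^{1/(2(α+1))}`. -/
def rho (α : ℝ) (Φ : Euc m → ℝ) (Ψ : Euc k → ℝ) (x : Euc m × Euc k) : ℝ :=
  (dualNorm Φ x.1 ^ (2 * (α + 1)) + 4 * (α + 1) ^ 2 * dualNorm Ψ x.2 ^ 2) ^ (1 / (2 * (α + 1)))

/-- Gradient in the `z` variables. -/
def gradZ (u : Euc m × Euc k → ℝ) (x : Euc m × Euc k) : Euc m :=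
  gradient (fun z => u (z, x.2)) x.1

/-- Gradient in the `σ` variables. -/
def gradS (u : Euc m × Euc k → ℝ) (x : Euc m × Euc k) : Euc k :=
  gradient (fun σ => u (x.1, σ)) x.2

/-- Divergence in the `z` variables. -/
def divZ (V : Euc m × Euc k → Euc m) (x : Euc m × Euc k) : ℝ :=
  ∑ i, fderiv ℝ (fun z => V (z, x.2) i) x.1 (EuclideanSpace.single i 1)

/-- Divergence in the `σ` variables. -/
def divS (V : Euc m × Euc k → Euc k) (x : Euc m × Euc k) : ℝ :=
  ∑ i, fderiv ℝ (fun σ => V (x.1, σ) i) x.2 (EuclideanSpace.single i 1)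

/-- The Finsler Laplacian in the `z` variables, `Δ_Φ(u) = div_z(Φ(∇_z u) ∇Φ(∇_z u))`. -/
def finslerLapZ (Φ : Euc m → ℝ) (u : Euc m × Euc k → ℝ) (x : Euc m × Euc k) : ℝ :=
  divZ (fun y => Φ (gradZ u y) • gradient Φ (gradZ u y)) x

/-- The Finsler Laplacian in the `σ` variables, `Δ_Ψ(u) = div_σ(Ψ(∇_σ u) ∇Ψ(∇_σ u))`. -/
def finslerLapS (Ψ : Euc k → ℝ) (u : Euc m × Euc k → ℝ) (x : Euc m × Euc k) : ℝ :=
  divS (fun y => Ψ (gradS u y) • gradient Ψ (gradS u y)) x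

/-- The operator `𝓛_{α,p}`. -/
def Lop (α p : ℝ) (Φ : Euc m → ℝ) (Ψ : Euc k → ℝ) (u : Euc m × Euc k → ℝ)
    (x : Euc m × Euc k) : ℝ :=
  divZ (fun y =>
      (Φ (gradZ u y) ^ 2 + dualNorm Φ y.1 ^ (2 * α) / 4 * Ψ (gradS u y) ^ 2) ^ ((p - 2) / 2) •
        (Φ (gradZ u y) • gradient Φ (gradZ u y))) x
  + divS (fun y =>
      (Φ (gradZ u y) ^ 2 + dualNorm Φ y.1 ^ (2 * α) / 4 * Ψ (gradS u y) ^ 2) ^ ((p - 2) / 2) •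
        ((dualNorm Φ y.1 ^ (2 * α) / 4 * Ψ (gradS u y)) • gradient Ψ (gradS u y))) x

/-- The operator `𝓛_{α,2}(u) = Δ_Φ(u) + (Φ⁰(z)^{2α}/4) Δ_Ψ(u)`. -/
def Lop2 (α : ℝ) (Φ : Euc m → ℝ) (Ψ : Euc k → ℝ) (u : Euc m × Euc k → ℝ)
    (x : Euc m × Euc k) : ℝ :=
  finslerLapZ Φ u x + dualNorm Φ x.1 ^ (2 * α) / 4 * finslerLapS Ψ u x

open Filter Topology

namespace IsMinkowskiNorm

variable {n : ℕ} {N : Euc n → ℝ}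

lemma map_zero (hN : IsMinkowskiNorm N) : N 0 = 0 := by
  simpa using hN.2.1 0 0

lemma map_pos (hN : IsMinkowskiNorm N) {x : Euc n} (hx : x ≠ 0) : 0 < N x := by
  refine lt_of_le_of_ne (hN.1 x) fun h => ?_
  have h1 := hN.2.2.2.2 (Set.mem_univ x) (Set.mem_univ 0) hx (one_half_pos (α := ℝ))
    one_half_pos (add_halves 1)
  simp [hN.map_zero, hN.2.1, ← h] at h1

lemma map_neg (hN : IsMinkowskiNorm N) (x : Euc n) : N (-x) = N x := by
  simpa using hN.2.1 (-1) x

lemma continuous (hN : IsMinkowskiNorm N) : Continuous N := by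
  have h := hN.2.2.2.convexOn.continuousOn isOpen_univ
  rw [← continuousOn_univ]
  refine h.sqrt.congr fun x _ => ?_
  exact (Real.sqrt_sq (hN.1 x)).symm

lemma differentiableAt (hN : IsMinkowskiNorm N) {x : Euc n} (hx : x ≠ 0) :
    DifferentiableAt ℝ N x := by
  have h := ((hN.2.2.1.contDiffAt (isOpen_compl_singleton.mem_nhds hx)).differentiableAt
    (by norm_num)).sqrt (pow_pos (hN.map_pos hx) 2).ne'
  refine h.congr_of_eventuallyEq (Eventually.of_forall fun y => ?_)
  exact (Real.sqrt_sq (hN.1 y)).symm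

lemma isCompact_sphere (hN : IsMinkowskiNorm N) : IsCompact {ξ | N ξ = 1} := by
  refine Metric.isCompact_of_isClosed_isBounded (isClosed_eq hN.continuous continuous_const) ?_
  rcases (Metric.sphere (0 : Euc n) 1).eq_empty_or_nonempty with he | hne
  · refine (Set.subsingleton_of_forall_eq 0 fun y _ => ?_).finite.isBounded
    by_contra hy
    have : (‖y‖⁻¹ • y) ∈ Metric.sphere (0 : Euc n) 1 := by
      simp [norm_smul, hy]
    simp [he] at this
  · obtain ⟨e, he, hmin⟩ := (_root_.isCompact_sphere (0 : Euc n) 1).exists_isMinOn hne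
      hN.continuous.continuousOn
    have he0 : e ≠ 0 := by
      rintro rfl
      simp at he
    have hpos := hN.map_pos he0
    refine (Metric.isBounded_closedBall (x := (0 : Euc n)) (r := (N e)⁻¹)).subset fun y hy => ?_
    have hy0 : y ≠ 0 := by
      rintro rfl
      simp [hN.map_zero] at hy
    have h1 : N e ≤ N (‖y‖⁻¹ • y) := hmin (by simp [norm_smul, hy0])
    rw [hN.2.1, Set.mem_ofPred_eq.mp hy, abs_of_pos (by positivity), mul_one] at h1
    rw [mem_closedBall_zero_iff]
    exact (le_inv_comm₀ hpos (norm_pos_iff.mpr hy0)).mp h1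

lemma exists_sphere (hn : 1 ≤ n) (hN : IsMinkowskiNorm N) : {ξ | N ξ = 1}.Nonempty := by
  have : NeZero n := ⟨by omega⟩
  obtain ⟨y, hy⟩ := exists_ne (0 : Euc n)
  refine ⟨(N y)⁻¹ • y, ?_⟩
  have := hN.map_pos hy
  rw [Set.mem_ofPred_eq, hN.2.1, abs_of_pos (by positivity), inv_mul_cancel₀ this.ne']

lemma exists_dualNorm_eq (hn : 1 ≤ n) (hN : IsMinkowskiNorm N) (x : Euc n) :
    ∃ ξ, N ξ = 1 ∧ ⟪x, ξ⟫ = dualNorm N x := by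
  obtain ⟨ξ, h1, h2⟩ := (hN.isCompact_sphere.image (f := fun ξ => ⟪x, ξ⟫)
    (by fun_prop)).sSup_mem ((hN.exists_sphere hn).image _)
  exact ⟨ξ, h1, h2⟩

lemma inner_le (hN : IsMinkowskiNorm N) (x ξ : Euc n) : ⟪x, ξ⟫ ≤ dualNorm N x * N ξ := by
  rcases eq_or_ne ξ 0 with rfl | hξ
  · simp [hN.map_zero]
  have hp := hN.map_pos hξ
  have h : ⟪x, (N ξ)⁻¹ • ξ⟫ ≤ dualNorm N x := by
    refine le_csSup (hN.isCompact_sphere.image (f := fun ξ => ⟪x, ξ⟫) (by fun_prop)).bddAbove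
      ⟨(N ξ)⁻¹ • ξ, ?_, rfl⟩
    rw [Set.mem_ofPred_eq, hN.2.1, abs_of_pos (by positivity), inv_mul_cancel₀ hp.ne']
  rw [inner_smul_right, inv_mul_le_iff₀ hp] at h
  linarith

lemma dualNorm_pos (hN : IsMinkowskiNorm N) {x : Euc n} (hx : x ≠ 0) : 0 < dualNorm N x := by
  have h := hN.inner_le x x
  have h1 : 0 < ⟪x, x⟫ := by
    rw [real_inner_self_eq_norm_sq]
    positivity
  exact pos_of_mul_pos_left (h1.trans_le h) (hN.1 x)

lemma dualNorm_zero (hn : 1 ≤ n) (hN : IsMinkowskiNorm N) : dualNorm N 0 = 0 := by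
  obtain ⟨ξ, -, h⟩ := hN.exists_dualNorm_eq hn 0
  simpa using h.symm

lemma dualNorm_nonneg (hn : 1 ≤ n) (hN : IsMinkowskiNorm N) (x : Euc n) : 0 ≤ dualNorm N x := by
  rcases eq_or_ne x 0 with rfl | hx
  · exact (hN.dualNorm_zero hn).ge
  · exact (hN.dualNorm_pos hx).le

lemma continuous_dualNorm (hn : 1 ≤ n) (hN : IsMinkowskiNorm N) : Continuous (dualNorm N) := by
  have h : ConvexOn ℝ Set.univ (dualNorm N) := by
    refine ⟨convex_univ, fun x _ y _ a b ha hb _ => ?_⟩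
    obtain ⟨ξ, h1, h2⟩ := hN.exists_dualNorm_eq hn (a • x + b • y)
    have hx := hN.inner_le x ξ
    have hy := hN.inner_le y ξ
    rw [h1, mul_one] at hx hy
    rw [← h2, inner_add_left, real_inner_smul_left, real_inner_smul_left]
    simp only [smul_eq_mul]
    gcongr
  rw [← continuousOn_univ]
  exact h.continuousOn isOpen_univ

/-- Strict convexity makes the point where the dual norm is attained unique. -/
lemma eq_of_inner_eq_dualNorm (hN : IsMinkowskiNorm N) {x ξ η : Euc n} (hx : x ≠ 0)
    (hξ : N ξ = 1) (hη : N η = 1) (h1 : ⟪x, ξ⟫ = dualNorm N x) (h2 : ⟪x, η⟫ = dualNorm N x) :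
    ξ = η := by
  by_contra hne
  have h := hN.2.2.2.2 (Set.mem_univ ξ) (Set.mem_univ η) hne (one_half_pos (α := ℝ))
    one_half_pos (add_halves 1)
  simp only [hξ, hη, smul_eq_mul] at h
  have hlt : N ((1 / 2 : ℝ) • ξ + (1 / 2 : ℝ) • η) < 1 := by
    nlinarith [hN.1 ((1 / 2 : ℝ) • ξ + (1 / 2 : ℝ) • η)]
  have hle := hN.inner_le x ((1 / 2 : ℝ) • ξ + (1 / 2 : ℝ) • η)
  rw [inner_add_right, inner_smul_right, inner_smul_right, h1, h2] at hle
  nlinarith [hN.dualNorm_pos hx]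

lemma hasGradientAt_dualNorm (hn : 1 ≤ n) (hN : IsMinkowskiNorm N) {x ξ : Euc n} (hx : x ≠ 0)
    (hξ : N ξ = 1) (h : ⟪x, ξ⟫ = dualNorm N x) : HasGradientAt (dualNorm N) ξ x := by
  choose f hf1 hf2 using hN.exists_dualNorm_eq hn
  have hlim : Tendsto f (𝓝 x) (𝓝 ξ) := by
    refine hN.isCompact_sphere.tendsto_nhds_of_unique_mapClusterPt
      (Eventually.of_forall hf1) fun η hη hc => ?_
    obtain ⟨U, hU, hU'⟩ := mapClusterPt_iff_ultrafilter.mp hc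
    refine (hN.eq_of_inner_eq_dualNorm hx hξ hη h ?_).symm
    have hx' : Tendsto (fun y => y) (U : Filter (Euc n)) (𝓝 x) := hU
    have hD : Tendsto (dualNorm N) (U : Filter (Euc n)) (𝓝 (dualNorm N x)) :=
      ((hN.continuous_dualNorm hn).tendsto x).comp hx'
    refine tendsto_nhds_unique ((hx'.inner hU').congr fun y => ?_) hD
    exact hf2 y
  rw [hasGradientAt_iff_hasFDerivAt]
  refine .of_isLittleO (Asymptotics.isLittleO_iff.mpr fun c hc => ?_)
  filter_upwards [Metric.tendsto_nhds.mp hlim c hc] with y hy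
  rw [dist_eq_norm] at hy
  have h1 : ⟪y, ξ⟫ ≤ dualNorm N y := by simpa [hξ] using hN.inner_le y ξ
  have h2 : ⟪x, f y⟫ ≤ dualNorm N x := by simpa [hf1] using hN.inner_le x (f y)
  have h3 := real_inner_le_norm (y - x) (f y - ξ)
  rw [InnerProductSpace.toDual_apply_apply, real_inner_comm, Real.norm_eq_abs, abs_of_nonneg]
  · have : ‖y - x‖ * ‖f y - ξ‖ ≤ c * ‖y - x‖ := by
      rw [mul_comm]
      gcongr
    simp only [inner_sub_left, inner_sub_right, hf2, h] at *
    linarith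
  · simp only [inner_sub_left, h]
    linarith

/-- The duality map `c ξ ↦ N(c ξ) ∇N(c ξ)` inverts `∇N⁰`. -/
lemma smul_gradient_eq (hN : IsMinkowskiNorm N) {x ξ : Euc n} (hx : x ≠ 0)
    (hξ : N ξ = 1) (h : ⟪x, ξ⟫ = dualNorm N x) (c : ℝ) :
    N (c • ξ) • gradient N (c • ξ) = (c / dualNorm N x) • x := by
  rcases eq_or_ne c 0 with rfl | hc
  · simp [hN.map_zero]
  have hξ0 : ξ ≠ 0 := by
    rintro rfl
    simp [hN.map_zero] at hξ
  have hD := hN.dualNorm_pos hx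
  have hd := (hN.differentiableAt (smul_ne_zero hc hξ0)).hasGradientAt
  rw [hasGradientAt_iff_hasFDerivAt] at hd
  have hcabs : 0 < |c| := abs_pos.mpr hc
  have hmin : IsLocalMin (fun η => dualNorm N x * N η - ⟪(c / |c|) • x, η⟫) (c • ξ) := by
    refine Eventually.of_forall fun η => ?_
    have e : dualNorm N x * N (c • ξ) - ⟪(c / |c|) • x, c • ξ⟫ = 0 := by
      rw [hN.2.1, hξ, real_inner_smul_left, inner_smul_right, h]
      field_simp
      rw [sq_abs]
      ring
    simp only [e]
    rw [real_inner_smul_left]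
    rcases hc.lt_or_gt with hneg | hpos
    · have := hN.inner_le x (-η)
      rw [hN.map_neg, inner_neg_right] at this
      rw [abs_of_neg hneg, div_neg, div_self hc]
      linarith
    · rw [abs_of_pos hpos, div_self hc]
      linarith [hN.inner_le x η]
  have hz := hmin.hasFDerivAt_eq_zero ((hd.const_mul (dualNorm N x)).sub
    (InnerProductSpace.toDual ℝ (Euc n) ((c / |c|) • x)).hasFDerivAt)
  rw [← map_smul, ← map_sub] at hz
  have hz' := sub_eq_zero.mp ((LinearIsometryEquiv.map_eq_zero_iff _).mp hz)
  have hg : gradient N (c • ξ) = (c / |c| / dualNorm N x) • x := by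
    rw [div_eq_inv_mul, mul_smul, ← hz', smul_smul, inv_mul_cancel₀ hD.ne', one_smul]
  rw [hg, hN.2.1, hξ, smul_smul]
  congr 1
  field_simp

lemma hasGradientAt_dualNorm_rpow (hn : 1 ≤ n) (hN : IsMinkowskiNorm N) {p : ℝ} (hp : 1 < p)
    {x ξ : Euc n} (hξ : N ξ = 1) (h : ⟪x, ξ⟫ = dualNorm N x) :
    HasGradientAt (fun z => dualNorm N z ^ p) ((p * dualNorm N x ^ (p - 1)) • ξ) x := by
  rw [hasGradientAt_iff_hasFDerivAt, map_smul]
  rcases eq_or_ne x 0 with rfl | hx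
  · rw [hN.dualNorm_zero hn, Real.zero_rpow (by linarith), mul_zero, zero_smul]
    obtain ⟨R, hR0, hR⟩ := hN.isCompact_sphere.isBounded.exists_pos_norm_le
    have hb (z : Euc n) : dualNorm N z ≤ R * ‖z‖ := by
      obtain ⟨η, h1, h2⟩ := hN.exists_dualNorm_eq hn z
      rw [← h2, mul_comm]
      exact (real_inner_le_norm _ _).trans (by gcongr; exact hR η h1)
    refine .of_isLittleO (Asymptotics.isLittleO_iff.mpr fun c hc => ?_)
    have hlim : Tendsto (fun z => R * dualNorm N z ^ (p - 1)) (𝓝 0) (𝓝 0) := by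
      have := (((hN.continuous_dualNorm hn).rpow_const (p := p - 1)
        fun _ => .inr (by linarith)).const_mul R).tendsto 0
      simpa [hN.dualNorm_zero hn, Real.zero_rpow (show p - 1 ≠ 0 by linarith)] using this
    filter_upwards [hlim.eventually_lt_const hc] with z hz
    have hz0 := hN.dualNorm_nonneg hn z
    rw [hN.dualNorm_zero hn, Real.zero_rpow (by linarith)]
    simp only [sub_zero, zero_apply, Real.norm_eq_abs]
    rw [abs_of_nonneg (by positivity)]
    calc dualNorm N z ^ p = dualNorm N z ^ (p - 1) * dualNorm N z := by
          rw [← Real.rpow_add_one' hz0 (by linarith), sub_add_cancel]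
      _ ≤ dualNorm N z ^ (p - 1) * (R * ‖z‖) := by gcongr; exact hb z
      _ = R * dualNorm N z ^ (p - 1) * ‖z‖ := by ring
      _ ≤ c * ‖z‖ := by gcongr
  · exact (hasGradientAt_iff_hasFDerivAt.mp (hN.hasGradientAt_dualNorm hn hx hξ h)).rpow_const
      (.inl (hN.dualNorm_pos hx).ne')

end IsMinkowskiNorm

/-- The divergence of `z ↦ K(z) z`. -/
lemma sum_fderiv_smul_self {n : ℕ} {K : Euc n → ℝ} {K' : StrongDual ℝ (Euc n)} {x : Euc n}
    (h : HasFDerivAt K K' x) :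
    ∑ i, fderiv ℝ (fun z : Euc n => (K z • z) i) x (EuclideanSpace.single i 1) =
      n * K x + K' x := by
  have hd (i : Fin n) : HasFDerivAt (fun z : Euc n => (K z • z) i)
      (K x • (EuclideanSpace.proj i : Euc n →L[ℝ] ℝ) + x i • K') x :=
    h.mul (EuclideanSpace.proj i : Euc n →L[ℝ] ℝ).hasFDerivAt
  have hx : ∑ i, x i • EuclideanSpace.single i (1 : ℝ) = x := by
    simpa using (EuclideanSpace.basisFun (Fin n) ℝ).sum_repr x
  have hK : K' x = ∑ i, x i * K' (EuclideanSpace.single i 1) := by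
    conv_lhs => rw [← hx]
    simp
  have hi (i : Fin n) : fderiv ℝ (fun z : Euc n => (K z • z) i) x (EuclideanSpace.single i 1) =
      K x + x i * K' (EuclideanSpace.single i 1) := by
    rw [(hd i).fderiv]
    simp
  simp only [hi, Finset.sum_add_distrib, ← hK]
  simp

/-- At the origin, continuity of `K` suffices to compute the divergence of `z ↦ K(z) z`. -/
lemma sum_fderiv_smul_self_zero {n : ℕ} {K : Euc n → ℝ} (h : ContinuousAt K 0) :
    ∑ i, fderiv ℝ (fun z : Euc n => (K z • z) i) 0 (EuclideanSpace.single i 1) = n * K 0 := by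
  have hd (i : Fin n) : HasFDerivAt (fun z : Euc n => (K z • z) i)
      (K 0 • (EuclideanSpace.proj i : Euc n →L[ℝ] ℝ)) 0 := by
    refine .of_isLittleO (Asymptotics.isLittleO_iff.mpr fun c hc => ?_)
    filter_upwards [Metric.tendsto_nhds.mp h c hc] with z hz
    rw [Real.dist_eq] at hz
    have hzi : |z i| ≤ ‖z‖ := PiLp.norm_apply_le z i
    simp only [PiLp.smul_apply, PiLp.zero_apply, smul_eq_mul, mul_zero, sub_zero,
      smul_apply, PiLp.proj_apply, Real.norm_eq_abs]
    rw [← sub_mul, abs_mul]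
    gcongr
  have hi (i : Fin n) : fderiv ℝ (fun z : Euc n => (K z • z) i) 0 (EuclideanSpace.single i 1) =
      K 0 := by
    rw [(hd i).fderiv]
    simp
  simp only [hi]
  simp

/-- The Finsler Laplacian of a function `G(A N⁰(z)^p + B)`. -/
lemma IsMinkowskiNorm.finslerLaplacian_comp_dualNorm_rpow {n : ℕ} (hn : 1 ≤ n) {N : Euc n → ℝ}
    (hN : IsMinkowskiNorm N) {p A B : ℝ} (hp : 2 ≤ p) {G g : ℝ → ℝ} {g' : ℝ}
    (hG : ∀ w, 0 < w → HasDerivAt G (g w) w) {x : Euc n} (hx : 0 < A * dualNorm N x ^ p + B)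
    (hg : HasDerivAt g g' (A * dualNorm N x ^ p + B)) :
    ∑ i, fderiv ℝ (fun z => (N (gradient (fun y => G (A * dualNorm N y ^ p + B)) z) •
        gradient N (gradient (fun y => G (A * dualNorm N y ^ p + B)) z)) i) x
        (EuclideanSpace.single i 1) =
      A * p * dualNorm N x ^ (p - 2) * ((n + p - 2) * g (A * dualNorm N x ^ p + B) +
        g' * (A * p * dualNorm N x ^ p)) := by
  have hcont : Continuous fun z => A * dualNorm N z ^ p + B :=
    (((hN.continuous_dualNorm hn).rpow_const fun _ => .inr (by linarith)).const_mul A).add_const B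
  have hw {z ξ : Euc n} (hξ : N ξ = 1) (h : ⟪z, ξ⟫ = dualNorm N z) :
      HasFDerivAt (fun y => A * dualNorm N y ^ p + B)
        (A • InnerProductSpace.toDual ℝ (Euc n) ((p * dualNorm N z ^ (p - 1)) • ξ)) z :=
    ((hasGradientAt_iff_hasFDerivAt.mp
      (hN.hasGradientAt_dualNorm_rpow hn (by linarith) hξ h)).const_mul A).add_const B
  set K : Euc n → ℝ := fun z =>
    A * p * (dualNorm N z ^ (p - 2) * g (A * dualNorm N z ^ p + B)) with hK
  have hfield : ∀ᶠ z in 𝓝 x, N (gradient (fun y => G (A * dualNorm N y ^ p + B)) z) •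
      gradient N (gradient (fun y => G (A * dualNorm N y ^ p + B)) z) = K z • z := by
    filter_upwards [hcont.continuousAt.eventually_const_lt hx] with z hz
    obtain ⟨ξ, hξ, h⟩ := hN.exists_dualNorm_eq hn z
    have hgrad : gradient (fun y => G (A * dualNorm N y ^ p + B)) z =
        (g (A * dualNorm N z ^ p + B) * A * (p * dualNorm N z ^ (p - 1))) • ξ := by
      refine HasGradientAt.gradient (hasGradientAt_iff_hasFDerivAt.mpr ?_)
      have := (hG _ hz).comp_hasFDerivAt z (hw hξ h)
      simp only [map_smul, smul_smul, mul_assoc] at this ⊢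
      exact this
    rw [hgrad]
    rcases eq_or_ne z 0 with rfl | hz0
    · simp [hN.dualNorm_zero hn, Real.zero_rpow (show p - 1 ≠ 0 by linarith), hN.map_zero]
    · rw [hN.smul_gradient_eq hz0 hξ h]
      congr 1
      have hD := hN.dualNorm_pos hz0
      rw [hK, show p - 1 = (p - 2) + 1 by ring, Real.rpow_add_one hD.ne']
      field_simp
  have hsum (i : Fin n) : fderiv ℝ
      (fun z => (N (gradient (fun y => G (A * dualNorm N y ^ p + B)) z) •
        gradient N (gradient (fun y => G (A * dualNorm N y ^ p + B)) z)) i) x =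
      fderiv ℝ (fun z : Euc n => (K z • z) i) x :=
    Filter.EventuallyEq.fderiv_eq (hfield.mono fun z hz => by simp only [hz])
  simp only [hsum]
  rcases eq_or_ne x 0 with rfl | hx0
  · rw [sum_fderiv_smul_self_zero, hK]
    · simp only [hN.dualNorm_zero hn, Real.zero_rpow (show p ≠ 0 by linarith)]
      rcases hp.eq_or_lt with rfl | hp
      · simp
        ring
      · simp [Real.zero_rpow (show p - 2 ≠ 0 by linarith)]
    · exact (((hN.continuous_dualNorm hn).rpow_const fun _ => .inr (by linarith)).continuousAt.mul
        (hg.continuousAt.comp_of_eq hcont.continuousAt rfl)).const_mul _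
  · obtain ⟨ξ, hξ, h⟩ := hN.exists_dualNorm_eq hn x
    have hD := hN.dualNorm_pos hx0
    have h1 := (hasGradientAt_iff_hasFDerivAt.mp
      (hN.hasGradientAt_dualNorm hn hx0 hξ h)).rpow_const (p := p - 2) (.inl hD.ne')
    have h2 := hg.comp_hasFDerivAt x (hw hξ h)
    have hKd : HasFDerivAt K _ x := (h1.mul h2).const_mul (A * p)
    rw [sum_fderiv_smul_self hKd, hK]
    simp only [Function.comp_apply, smul_apply, add_apply,
      InnerProductSpace.toDual_apply_apply, real_inner_smul_left, real_inner_comm x ξ ▸ h,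
      smul_eq_mul]
    have e1 : dualNorm N x ^ (p - 2) = dualNorm N x ^ (p - 2 - 1) * dualNorm N x := by
      rw [← Real.rpow_add_one hD.ne', sub_add_cancel]
    have e2 : dualNorm N x ^ p = dualNorm N x ^ (p - 1) * dualNorm N x := by
      rw [← Real.rpow_add_one hD.ne', sub_add_cancel]
    generalize g (A * dualNorm N x ^ p + B) = γ
    rw [e1, e2]
    ring

/-- Radial action of `𝓛_{α,2}`: for `F ∈ C²((0,∞))`,
`𝓛_{α,2}(F∘ρ) = (F''(ρ) + ((Q−1)/ρ)F'(ρ))(Φ⁰(z)/ρ)^{2α}` on `ℝ^N ∖ {0}`; in particular,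
the nonlinear operator `𝓛_{α,2}` acts linearly on functions of `ρ`. -/
theorem Lop2_radial_formula (m k : ℕ) (hm : 1 ≤ m) (hk : 1 ≤ k)
    (α : ℝ) (hα : 0 < α)
    (Φ : Euc m → ℝ) (Ψ : Euc k → ℝ) (hΦ : IsMinkowskiNorm Φ) (hΨ : IsMinkowskiNorm Ψ)
    (Q : ℝ) (hQ : Q = (m : ℝ) + (α + 1) * (k : ℝ))
    (F : ℝ → ℝ) (hF : ContDiffOn ℝ 2 F (Set.Ioi 0)) :
    ∀ x : Euc m × Euc k, x ≠ 0 →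
      Lop2 α Φ Ψ (fun y => F (rho α Φ Ψ y)) x =
        (deriv (deriv F) (rho α Φ Ψ x) + (Q - 1) / rho α Φ Ψ x * deriv F (rho α Φ Ψ x)) *
          (dualNorm Φ x.1 / rho α Φ Ψ x) ^ (2 * α) := by
  intro x hx
  have hP0 : 0 < 2 * (α + 1) := by linarith
  obtain ⟨P, hP⟩ : ∃ P, P = 2 * (α + 1) := ⟨_, rfl⟩
  have hα' : α = P / 2 - 1 := by linarith
  rw [← hP] at hP0
  have hF' := hF.deriv_of_isOpen (m := 1) isOpen_Ioi (by norm_num)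
  have hd1 (r : ℝ) (hr : 0 < r) : HasDerivAt F (deriv F r) r :=
    ((hF.contDiffAt (Ioi_mem_nhds hr)).differentiableAt (by norm_num)).hasDerivAt
  have hd2 (r : ℝ) (hr : 0 < r) : HasDerivAt (deriv F) (deriv (deriv F) r) r :=
    ((hF'.contDiffAt (Ioi_mem_nhds hr)).differentiableAt (by norm_num)).hasDerivAt
  have hpow (w : ℝ) (hw : 0 < w) :
      HasDerivAt (fun w : ℝ => w ^ (1 / P)) (1 / P * w ^ (1 / P - 1)) w :=
    Real.hasDerivAt_rpow_const (.inl hw.ne')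
  set g : ℝ → ℝ := fun w => deriv F (w ^ (1 / P)) * (1 / P * w ^ (1 / P - 1)) with hg
  have hG (w : ℝ) (hw : 0 < w) : HasDerivAt (fun w => F (w ^ (1 / P))) (g w) w :=
    (hd1 _ (Real.rpow_pos_of_pos hw _)).comp
      (h := fun w : ℝ => w ^ (1 / P)) w (hpow w hw)
  have hg' (w : ℝ) (hw : 0 < w) := ((hd2 _ (Real.rpow_pos_of_pos hw _)).comp
    (h := fun w : ℝ => w ^ (1 / P)) w (hpow w hw)).mul
    ((Real.hasDerivAt_rpow_const (p := 1 / P - 1) (.inl hw.ne')).const_mul (1 / P))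
  have hr0 := hΦ.dualNorm_nonneg hm x.1
  have hs0 := hΨ.dualNorm_nonneg hk x.2
  obtain ⟨w, hw⟩ : ∃ w, w = dualNorm Φ x.1 ^ P + P ^ 2 * dualNorm Ψ x.2 ^ 2 := ⟨_, rfl⟩
  have hwpos : 0 < w := by
    rw [hw]
    by_cases h1 : x.1 = 0
    · have h2 : x.2 ≠ 0 := fun h2 => hx (Prod.ext h1 h2)
      have := hΨ.dualNorm_pos h2
      positivity
    · have := hΦ.dualNorm_pos h1
      positivity
  have hrho (y : Euc m × Euc k) : rho α Φ Ψ y =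
      (dualNorm Φ y.1 ^ P + P ^ 2 * dualNorm Ψ y.2 ^ 2) ^ (1 / P) := by
    rw [rho, hP]
    ring_nf
  have eZ (z : Euc m) : 1 * dualNorm Φ z ^ P + P ^ 2 * dualNorm Ψ x.2 ^ 2 =
      dualNorm Φ z ^ P + P ^ 2 * dualNorm Ψ x.2 ^ 2 := by ring
  have eS (s : Euc k) : P ^ 2 * dualNorm Ψ s ^ (2 : ℝ) + dualNorm Φ x.1 ^ P =
      dualNorm Φ x.1 ^ P + P ^ 2 * dualNorm Ψ s ^ 2 := by
    rw [Real.rpow_two, add_comm]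
  have hZ := hΦ.finslerLaplacian_comp_dualNorm_rpow hm (p := P) (A := 1)
    (B := P ^ 2 * dualNorm Ψ x.2 ^ 2) (x := x.1) (by linarith) hG
    (by rwa [eZ, ← hw]) (by rw [eZ, ← hw]; exact hg' w hwpos)
  have hS := hΨ.finslerLaplacian_comp_dualNorm_rpow hk (p := 2) (A := P ^ 2)
    (B := dualNorm Φ x.1 ^ P) (x := x.2) le_rfl hG
    (by rwa [eS, ← hw]) (by rw [eS, ← hw]; exact hg' w hwpos)
  simp only [eZ, ← hw] at hZ
  simp only [eS, ← hw] at hS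
  simp only [Lop2, finslerLapZ, finslerLapS, divZ, divS, gradZ, gradS, hrho, ← hw]
  rw [hZ, hS, Real.div_rpow hr0 (by positivity), ← Real.rpow_mul hwpos.le]
  have a1 : 1 / P * (2 * α) = 1 - 2 * (1 / P) := by
    rw [hα']
    field_simp
  have a2 : P - 2 = 2 * α := by linarith
  have b1 : w ^ (1 / P - 1) = w ^ (1 / P) / w := Real.rpow_sub_one hwpos.ne' _
  have b2 : w ^ (1 / P - 1 - 1) = w ^ (1 / P) / w / w := by
    rw [Real.rpow_sub_one hwpos.ne', b1]
  have b3 : w ^ (1 - 2 * (1 / P)) = w / (w ^ (1 / P)) ^ 2 := by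
    rw [Real.rpow_sub hwpos, Real.rpow_one, mul_comm, Real.rpow_mul hwpos.le, Real.rpow_two]
  have hρ : 0 < w ^ (1 / P) := Real.rpow_pos_of_pos hwpos _
  rw [a1, a2, b3, hg, Function.comp_apply]
  simp only [b1, b2, sub_self, Real.rpow_zero, Real.rpow_two]
  generalize w ^ (1 / P) = R at *
  generalize deriv (deriv F) R = F₂
  generalize deriv F R = F₁
  rw [show dualNorm Φ x.1 ^ P = w - P ^ 2 * dualNorm Ψ x.2 ^ 2 by linarith, hQ, hα']
  field_simp
  ring
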